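/- arXiv:2004.13356 — 2 statements merged into one kernel-verified Lean document; each statement's English description precedes it below -/
import Mathlib

section
/- Let R be an integrable random orthogonal projection on ℝⁿ with average projection 𝖯 = E[R]. Then for any fixed vectors z, y, z* ∈ ℝⁿ, the expected squared distance after a projected update satisfies the exact identity E[‖z − z* + R(y − z)‖²] = ‖z − z*‖² + ⟨y − z*, 𝖯(y − z*)⟩ − ⟨z − z*, 𝖯(z − z*)⟩. -/
open MeasureTheory
open scoped RealInnerProductSpace

theorem statement2
    {n : ℕ} {Ω : Type*} [MeasurableSpace Ω] (μ : Measure Ω) [IsProbabilityMeasure μ]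
    (R : Ω → EuclideanSpace ℝ (Fin n) →L[ℝ] EuclideanSpace ℝ (Fin n))
    (hInt : Integrable R μ)
    (hProj : ∀ᵐ ω ∂μ,
      (∀ x y : EuclideanSpace ℝ (Fin n), ⟪R ω x, y⟫ = ⟪x, R ω y⟫) ∧
      (∀ x : EuclideanSpace ℝ (Fin n), R ω (R ω x) = R ω x))
    (P : EuclideanSpace ℝ (Fin n) →L[ℝ] EuclideanSpace ℝ (Fin n))
    (hP : P = ∫ ω, R ω ∂μ)
    (z y zstar : EuclideanSpace ℝ (Fin n)) :
    ∫ ω, ‖z - zstar + R ω (y - z)‖ ^ 2 ∂μ =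
      ‖z - zstar‖ ^ 2 + ⟪y - zstar, P (y - zstar)⟫ - ⟪z - zstar, P (z - zstar)⟫ := by
  have hI : ∀ v : EuclideanSpace ℝ (Fin n), Integrable (fun ω => ⟪v, R ω v⟫) μ := fun v =>
    (hInt.apply_continuousLinearMap v).const_inner v
  have hE : ∀ v : EuclideanSpace ℝ (Fin n), ∫ ω, ⟪v, R ω v⟫ ∂μ = ⟪v, P v⟫ := by
    intro v
    rw [hP, ContinuousLinearMap.integral_apply hInt]
    exact integral_inner (hInt.apply_continuousLinearMap v) v
  have hpt : ∀ᵐ ω ∂μ, ‖z - zstar + R ω (y - z)‖ ^ 2 =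
      ‖z - zstar‖ ^ 2 + ⟪y - zstar, R ω (y - zstar)⟫ - ⟪z - zstar, R ω (z - zstar)⟫ := by
    filter_upwards [hProj] with ω hω
    obtain ⟨hs, hi⟩ := hω
    have hd : y - z = (y - zstar) - (z - zstar) := by abel
    rw [hd]
    generalize y - zstar = b
    generalize z - zstar = a
    have h1 : ‖R ω (b - a)‖ ^ 2 = ⟪b - a, R ω (b - a)⟫ := by
      rw [← real_inner_self_eq_norm_sq, hs, hi]
    have h2 : ⟪a, R ω b⟫ = ⟪b, R ω a⟫ := by
      rw [← hs, real_inner_comm]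
    rw [norm_add_sq_real, h1]
    simp only [map_sub, inner_sub_left, inner_sub_right]
    linarith
  have hA : Integrable (fun ω => ‖z - zstar‖ ^ 2 + ⟪y - zstar, R ω (y - zstar)⟫) μ :=
    (integrable_const _).add (hI _)
  rw [integral_congr_ae hpt, integral_sub hA (hI _),
    integral_add (integrable_const _) (hI _), hE, hE]
  simp
end

section
/- Assume f : ℝⁿ → ℝ is differentiable, μ-strongly convex and L-smooth, g is convex, proper, lower semicontinuous, γ ∈ (0, 2/(μ+L)], and x* minimizes f + g over ℝⁿ. Let 𝖯 be symmetric positive definite with inverse square root Q = 𝖯^{-1/2} and eigenvalue lower bound λ > 0, and set z* = Q(x* − γ∇f(x*)). For any z ∈ ℝⁿ, let x be the proximal point prox_{γg}(Q⁻¹z) and y = Q(x − γ∇f(x)). Then ‖y − z*‖²_𝖯 − ‖z − z*‖²_𝖯 ≤ −λ · (2γμL/(μ+L)) · ‖z − z*‖². -/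
open MeasureTheory
open scoped RealInnerProductSpace

theorem aux_line {E : Type*} [NormedAddCommGroup E] [InnerProductSpace ℝ E] [CompleteSpace E]
    {f : E → ℝ} {p x v : E} {t : ℝ} (h : HasGradientAt f p (x + t • v)) :
    HasDerivAt (fun s : ℝ => f (x + s • v)) (inner ℝ p v) t := by
  have h1 : HasDerivAt (fun s : ℝ => x + s • v) v t := by
    simpa using ((hasDerivAt_id t).smul_const v).const_add x
  have h2 := h.hasFDerivAt.comp_hasDerivAt t h1
  exact h2.congr_deriv (by simp)

theorem aux_first {E : Type*} [NormedAddCommGroup E] [InnerProductSpace ℝ E] [CompleteSpace E]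
    {f : E → ℝ} {p x v : E} {c : ℝ} (h : HasGradientAt f p x)
    (hmin : ∀ t : ℝ, 0 < t → t ≤ 1 → f x ≤ f (x + t • v) + t * c) :
    0 ≤ inner ℝ p v + c := by
  have h1 : HasDerivAt (fun s : ℝ => f (x + s • v)) (inner ℝ p v) 0 := by
    apply aux_line; simpa using h
  have h2 : HasDerivAt (fun s : ℝ => f (x + s • v) + s * c) (inner ℝ p v + c) 0 := by
    exact (h1.add ((hasDerivAt_id (0:ℝ)).mul_const c)).congr_deriv (by simp)
  refine ge_of_tendsto h2.tendsto_slope_zero_right ?_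
  filter_upwards [Ioc_mem_nhdsGT (show (0:ℝ) < 1 by norm_num)] with t ht
  have := hmin t ht.1 ht.2
  have ht' := ht.1
  simp only [zero_add, zero_smul, add_zero, zero_mul, smul_eq_mul]
  apply mul_nonneg (by positivity)
  linarith

theorem aux_sub {E : Type*} [NormedAddCommGroup E] [InnerProductSpace ℝ E] [CompleteSpace E]
    {f : E → ℝ} {g : E → EReal} {p x v : E} {a b : ℝ} (h : HasGradientAt f p x)
    (hg_conv : ∀ x y : E, ∀ a b : ℝ, 0 ≤ a → 0 ≤ b → a + b = 1 →
      g (a • x + b • y) ≤ (a : EReal) * g x + (b : EReal) * g y)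
    (hmin : ∀ v, (f x : EReal) + g x ≤ f v + g v) (ha : g x = a) (hb : g v = b) :
    a ≤ b + inner ℝ p (v - x) := by
  have := aux_first (v := v - x) (c := b - a) h (by
    intro t ht ht1
    have h1 := hg_conv x v (1 - t) t (by linarith) ht.le (by ring)
    have e : (1 - t) • x + t • v = x + t • (v - x) := by module
    rw [e, ha, hb] at h1
    have h2 := hmin (x + t • (v - x))
    rw [ha] at h2
    have h3 := h2.trans (add_le_add_right h1 _)
    norm_cast at h3
    linarith)
  linarith

theorem aux_ne_top {E : Type*} {f : E → ℝ} {g : E → EReal} {x : E}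
    (hp : ∃ x, g x ≠ ⊤) 
    (hmin : ∀ v, (f x : EReal) + g x ≤ f v + g v) : g x ≠ ⊤ := by
  intro h
  obtain ⟨v, hv⟩ := hp
  have := hmin v
  rw [h, EReal.coe_add_top, top_le_iff] at this
  exact EReal.add_ne_top (EReal.coe_ne_top _) hv this

theorem aux_descent {E : Type*} [NormedAddCommGroup E] [InnerProductSpace ℝ E] [CompleteSpace E]
    {f : E → ℝ} {f' : E → E} {L : ℝ} 
    (hgrad : ∀ x, HasGradientAt f (f' x) x)
    (hsmooth : ∀ x y, ‖f' x - f' y‖ ≤ L * ‖x - y‖) (x v : E) :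
    f (x + v) ≤ f x + inner ℝ (f' x) v + L / 2 * ‖v‖ ^ 2 := by
  have hd : ∀ t : ℝ, HasDerivAt
      (fun s : ℝ => f (x + s • v) - s * inner ℝ (f' x) v - L / 2 * ‖v‖ ^ 2 * s ^ 2)
      (inner ℝ (f' (x + t • v)) v - inner ℝ (f' x) v - L / 2 * ‖v‖ ^ 2 * (2 * t)) t := by
    intro t
    have h1 := aux_line (hgrad (x + t • v))
    have h2 := (hasDerivAt_id t).mul_const (inner ℝ (f' x) v)
    have h3 := (hasDerivAt_pow 2 t).const_mul (L / 2 * ‖v‖ ^ 2)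
    exact ((h1.sub h2).sub h3).congr_deriv (by simp)
  have := antitoneOn_of_deriv_nonpos (convex_Icc (0:ℝ) 1)
    (fun t _ => (hd t).continuousAt.continuousWithinAt)
    (fun t _ => (hd t).differentiableAt.differentiableWithinAt)
    (fun t ht => by
      rw [interior_Icc] at ht
      rw [(hd t).deriv, ← inner_sub_left]
      have h1 := real_inner_le_norm (f' (x + t • v) - f' x) v
      have h2 := hsmooth (x + t • v) x
      rw [add_sub_cancel_left, norm_smul, Real.norm_of_nonneg ht.1.le] at h2
      have h3 := mul_le_mul_of_nonneg_right h2 (norm_nonneg v)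
      nlinarith)
    (Set.left_mem_Icc.2 zero_le_one) (Set.right_mem_Icc.2 zero_le_one) zero_le_one
  simp at this
  linarith

theorem aux_strong {E : Type*} [NormedAddCommGroup E] [InnerProductSpace ℝ E] [CompleteSpace E]
    {f : E → ℝ} {p x : E} {m : ℝ} (h : HasGradientAt f p x)
    (hsc : StrongConvexOn Set.univ m f) (v : E) :
    f x + inner ℝ p v + m / 2 * ‖v‖ ^ 2 ≤ f (x + v) := by
  have hc := strongConvexOn_iff_convex.1 hsc
  have hc' : ∀ t : ℝ, 0 < t → t ≤ 1 → 
      f (x + t • v) - m / 2 * ‖x + t • v‖ ^ 2 ≤ (1 - t) * (f x - m / 2 * ‖x‖ ^ 2)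
        + t * (f (x + v) - m / 2 * ‖x + v‖ ^ 2) := by
    intro t ht ht1
    have := hc.2 (Set.mem_univ x) (Set.mem_univ (x + v)) (show 0 ≤ 1 - t by linarith) ht.le (by ring)
    have e : (1 - t) • x + t • (x + v) = x + t • v := by module
    rw [e] at this
    simpa using this
  have h1 : HasDerivAt (fun s : ℝ => f (x + s • v)) (inner ℝ p v) 0 := by
    apply aux_line; simpa using h
  have h2 : HasDerivAt (fun s : ℝ => f (x + s • v) - s * (f (x + v) - f x - m / 2 * ‖v‖ ^ 2)
      - m / 2 * ‖v‖ ^ 2 * s ^ 2)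
      (inner ℝ p v - (f (x + v) - f x - m / 2 * ‖v‖ ^ 2)) 0 := by
    exact ((h1.sub ((hasDerivAt_id (0:ℝ)).mul_const (f (x + v) - f x - m / 2 * ‖v‖ ^ 2))).sub
      ((hasDerivAt_pow 2 (0:ℝ)).const_mul (m / 2 * ‖v‖ ^ 2))).congr_deriv (by simp)
  have : inner ℝ p v - (f (x + v) - f x - m / 2 * ‖v‖ ^ 2) ≤ 0 := by
    refine le_of_tendsto h2.tendsto_slope_zero_right ?_
    filter_upwards [Ioc_mem_nhdsGT (show (0:ℝ) < 1 by norm_num)] with t ht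
    have := hc' t ht.1 ht.2
    have ht' := ht.1
    rw [norm_add_sq_real, norm_add_sq_real, inner_smul_right, norm_smul,
      Real.norm_of_nonneg ht'.le] at this
    simp only [zero_add, zero_smul, add_zero, zero_mul, smul_eq_mul]
    apply mul_nonpos_of_nonneg_of_nonpos (by positivity)
    nlinarith
  linarith

theorem aux_coer {E : Type*} [NormedAddCommGroup E] [InnerProductSpace ℝ E] [CompleteSpace E]
    {f : E → ℝ} {f' : E → E} {m L : ℝ} (hm : 0 < m) (hmL : m ≤ L)
    (hgrad : ∀ x, HasGradientAt f (f' x) x)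
    (hsc : StrongConvexOn Set.univ m f)
    (hsmooth : ∀ x y, ‖f' x - f' y‖ ≤ L * ‖x - y‖) (x y : E) :
    m * L * ‖x - y‖ ^ 2 + ‖f' x - f' y‖ ^ 2 ≤ (m + L) * inner ℝ (f' x - f' y) (x - y) := by
  rcases hmL.eq_or_lt with rfl | hlt
  · have h1 := aux_strong (hgrad x) hsc (y - x)
    have h2 := aux_strong (hgrad y) hsc (x - y)
    rw [add_sub_cancel] at h1 h2
    rw [← neg_sub x y, inner_neg_right, norm_neg] at h1
    have h3 := hsmooth x y
    rw [inner_sub_left]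
    have h4 := mul_self_le_mul_self (norm_nonneg _) h3
    have h5 : m * ‖x - y‖ ^ 2 ≤ inner ℝ (f' x) (x - y) - inner ℝ (f' y) (x - y) := by linarith
    nlinarith
  · have key : ∀ x y : E, ∀ t : ℝ, 
        f x + inner ℝ (f' x) (y - x) + m / 2 * ‖y - x‖ ^ 2
          + (t - (L - m) / 2 * t ^ 2) * ‖f' y - f' x - m • (y - x)‖ ^ 2 ≤ f y := by
      intro x y t
      set δ := f' y - f' x - m • (y - x) with hδ
      have h1 := aux_strong (hgrad x) hsc ((y - x) - t • δ)
      have h2 := aux_descent hgrad hsmooth y (-(t • δ))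
      have e : x + ((y - x) - t • δ) = y + -(t • δ) := by abel
      rw [e] at h1
      have h3 := h1.trans h2
      have e2 : inner ℝ (f' y) δ = inner ℝ (f' x) δ + m * inner ℝ (y - x) δ + ‖δ‖ ^ 2 := by
        have : f' y = f' x + m • (y - x) + δ := by rw [hδ]; abel
        rw [this, inner_add_left, inner_add_left, inner_smul_left, real_inner_self_eq_norm_sq]
        simp
      rw [norm_sub_sq_real, inner_sub_right, inner_neg_right, norm_neg, inner_smul_right,
        inner_smul_right, inner_smul_right, norm_smul, mul_pow, Real.norm_eq_abs, sq_abs, e2] at h3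
      nlinarith
    have hM : 0 < L - m := by linarith
    have k1 := key x y (1 / (L - m))
    have k2 := key y x (1 / (L - m))
    have ec : 1 / (L - m) - (L - m) / 2 * (1 / (L - m)) ^ 2 = 1 / (2 * (L - m)) := by
      field_simp; ring
    rw [ec] at k1 k2
    have en : f' y - f' x - m • (y - x) = -((f' x - f' y) - m • (x - y)) := by module
    rw [en, norm_neg, ← neg_sub x y, inner_neg_right, norm_neg] at k1
    have k3 : m * ‖x - y‖ ^ 2 + 1 / (L - m) * ‖(f' x - f' y) - m • (x - y)‖ ^ 2 
        ≤ inner ℝ (f' x - f' y) (x - y) := by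
      rw [inner_sub_left]
      have : 1 / (L - m) = 2 * (1 / (2 * (L - m))) := by field_simp
      rw [this]
      linarith
    have k4 := mul_le_mul_of_nonneg_left k3 hM.le
    rw [mul_add, ← mul_assoc (L - m) (1 / (L - m)), mul_one_div_cancel hM.ne', one_mul,
      norm_sub_sq_real (f' x - f' y), inner_smul_right, norm_smul, mul_pow, Real.norm_eq_abs,
      sq_abs] at k4
    nlinarith

theorem statement3
    {n : ℕ} (m L γ lam : ℝ)
    (f : EuclideanSpace ℝ (Fin n) → ℝ)
    (f' : EuclideanSpace ℝ (Fin n) → EuclideanSpace ℝ (Fin n))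
    (g : EuclideanSpace ℝ (Fin n) → EReal)
    (hm : 0 < m) (hmL : m ≤ L)
    (hgrad : ∀ x, HasGradientAt f (f' x) x)
    (hsc : StrongConvexOn Set.univ m f)
    (hsmooth : ∀ x y, ‖f' x - f' y‖ ≤ L * ‖x - y‖)
    (hg_conv : ∀ x y : EuclideanSpace ℝ (Fin n), ∀ a b : ℝ, 0 ≤ a → 0 ≤ b → a + b = 1 →
      g (a • x + b • y) ≤ (a : EReal) * g x + (b : EReal) * g y)
    (hg_ne_bot : ∀ x, g x ≠ ⊥) (hg_proper : ∃ x, g x ≠ ⊤)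
    (hg_lsc : LowerSemicontinuous g)
    (hγ0 : 0 < γ) (hγ : γ ≤ 2 / (m + L))
    (xstar : EuclideanSpace ℝ (Fin n))
    (hstar : IsMinOn (fun v => (f v : EReal) + g v) Set.univ xstar)
    (P Q Qinv : EuclideanSpace ℝ (Fin n) →L[ℝ] EuclideanSpace ℝ (Fin n))
    (hPsym : ∀ u v, ⟪P u, v⟫ = ⟪u, P v⟫)
    (hPpos : ∀ v, v ≠ 0 → 0 < ⟪v, P v⟫)
    (hQsym : ∀ u v, ⟪Q u, v⟫ = ⟪u, Q v⟫)
    (hQpos : ∀ v, v ≠ 0 → 0 < ⟪v, Q v⟫)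
    (hQQP : ∀ v, Q (Q (P v)) = v)
    (hPQQ : ∀ v, P (Q (Q v)) = v)
    (hQinv : ∀ v, Q (Qinv v) = v)
    (hQinv' : ∀ v, Qinv (Q v) = v)
    (hlam : 0 < lam)
    (hlamP : ∀ v, lam * ‖v‖ ^ 2 ≤ ⟪v, P v⟫)
    (zstar : EuclideanSpace ℝ (Fin n))
    (hzstar : zstar = Q (xstar - γ • f' xstar))
    (z x y : EuclideanSpace ℝ (Fin n))
    (hx : IsMinOn (fun v => g v + ((‖v - Qinv z‖ ^ 2 / (2 * γ) : ℝ) : EReal)) Set.univ x)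
    (hy : y = Q (x - γ • f' x)) :
    ⟪y - zstar, P (y - zstar)⟫ - ⟪z - zstar, P (z - zstar)⟫ ≤
      - (lam * (2 * γ * m * L / (m + L)) * ‖z - zstar‖ ^ 2) := by
  have hmLpos : 0 < m + L := by linarith
  have hγ' : γ * (m + L) ≤ 2 := by rwa [le_div_iff₀ hmLpos] at hγ
  have hPQ : ∀ a, ⟪Q a, P (Q a)⟫ = ‖a‖ ^ 2 := by
    intro a
    rw [hQsym]
    have : P (Q a) = Qinv a := by
      conv_lhs => rw [← hQinv a]
      exact hPQQ _
    rw [this, hQinv, real_inner_self_eq_norm_sq]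
  set w := Qinv z with hw
  have hz : z = Q w := (hQinv z).symm
  have hyz : y - zstar = Q ((x - γ • f' x) - (xstar - γ • f' xstar)) := by
    rw [hy, hzstar, ← map_sub]
  have hzz : z - zstar = Q (w - (xstar - γ • f' xstar)) := by
    rw [map_sub, ← hz, hzstar]
  have hl := hlamP (z - zstar)
  rw [hyz, hzz, hPQ, hPQ]
  rw [hzz, hPQ] at hl
  -- prox step
  have hs : ∀ v, (f xstar : EReal) + g xstar ≤ f v + g v := fun v => hstar (Set.mem_univ v)
  have hx' : ∀ v, ((‖x - w‖ ^ 2 / (2 * γ) : ℝ) : EReal) + g x ≤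
      ((‖v - w‖ ^ 2 / (2 * γ) : ℝ) : EReal) + g v := by
    intro v
    have := hx (Set.mem_univ v)
    simpa [add_comm] using this
  have t1 : g xstar ≠ ⊤ := aux_ne_top hg_proper hs
  have t2 : g x ≠ ⊤ := aux_ne_top (f := fun v => ‖v - w‖ ^ 2 / (2 * γ)) hg_proper hx'
  have r1 := (EReal.coe_toReal t1 (hg_ne_bot _)).symm
  have r2 := (EReal.coe_toReal t2 (hg_ne_bot _)).symm
  have gq : HasGradientAt (fun v => ‖v - w‖ ^ 2 / (2 * γ)) ((1 / γ) • (x - w)) x := by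
    rw [hasGradientAt_iff_hasFDerivAt]
    have h1 := ((hasFDerivAt_id (𝕜 := ℝ) x).sub_const w).norm_sq
    have h2 := h1.mul_const (1 / (2 * γ))
    simp only [← div_eq_mul_one_div] at h2
    refine h2.congr_fderiv ?_
    ext v
    simp [inner_smul_left]
    field_simp
  have s1 := aux_sub (hgrad xstar) hg_conv hs r1 r2
  have s2 := aux_sub gq hg_conv hx' r2 r1
  rw [inner_smul_left] at s2
  simp only [RCLike.conj_to_real] at s2
  rw [← neg_sub x xstar, inner_neg_right] at s2
  have s3 : 1 / γ * ⟪x - w, x - xstar⟫ ≤ ⟪f' xstar, x - xstar⟫ := by linarith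
  have s4 : ⟪x - w, x - xstar⟫ ≤ γ * ⟪f' xstar, x - xstar⟫ := by
    have := mul_le_mul_of_nonneg_left s3 hγ0.le
    rwa [← mul_assoc, mul_one_div_cancel hγ0.ne', one_mul] at this
  set a := x - xstar with ha
  set b := w - (xstar - γ • f' xstar) with hb
  set d := f' x - f' xstar with hd
  have s5 : ‖a‖ ^ 2 ≤ ⟪b, a⟫ := by
    have : x - w = a - b + γ • f' xstar := by rw [ha, hb]; abel
    rw [this, inner_add_left, inner_sub_left, inner_smul_left, real_inner_self_eq_norm_sq] at s4
    simp only [RCLike.conj_to_real] at s4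
    linarith
  have s6 : ‖a‖ ^ 2 ≤ ‖b‖ ^ 2 := by
    have := real_inner_le_norm b a
    nlinarith [sq_nonneg (‖a‖ - ‖b‖)]
  have e : x - γ • f' x - (xstar - γ • f' xstar) = a - γ • d := by rw [ha, hd]; module
  have co := aux_coer hm hmL hgrad hsc hsmooth x xstar
  rw [← ha, ← hd] at co
  rw [e, norm_sub_sq_real, inner_smul_right, norm_smul, mul_pow, Real.norm_eq_abs, sq_abs,
    real_inner_comm]
  set c := 2 * γ * m * L / (m + L) with hc
  have hL : 0 < L := by linarith
  have hc0 : 0 ≤ c := by positivity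
  have hc1 : c ≤ 1 := by
    rw [hc, div_le_one hmLpos]
    have h1 : γ * (m + L) * (m * L) ≤ 2 * (m * L) := 
      mul_le_mul_of_nonneg_right hγ' (by positivity)
    have : (2 * γ * m * L) * (m + L) ≤ (m + L) * (m + L) := by nlinarith [sq_nonneg (m - L)]
    exact le_of_mul_le_mul_right this hmLpos
  have step : ‖a‖ ^ 2 - 2 * (γ * ⟪d, a⟫) + γ ^ 2 * ‖d‖ ^ 2 ≤ (1 - c) * ‖a‖ ^ 2 := by
    have hcm : c * (m + L) = 2 * γ * m * L := by rw [hc]; field_simp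
    have h1 := mul_le_mul_of_nonneg_left co (show 0 ≤ 2 * γ by positivity)
    have h2 : γ * (m + L) * (γ * ‖d‖ ^ 2) ≤ 2 * (γ * ‖d‖ ^ 2) :=
      mul_le_mul_of_nonneg_right hγ' (by positivity)
    have h3 : c * (m + L) * ‖a‖ ^ 2 = 2 * γ * m * L * ‖a‖ ^ 2 := by rw [hcm]
    have : (m + L) * (‖a‖ ^ 2 - 2 * (γ * ⟪d, a⟫) + γ ^ 2 * ‖d‖ ^ 2) ≤
      (m + L) * ((1 - c) * ‖a‖ ^ 2) := by nlinarith
    exact le_of_mul_le_mul_left this hmLpos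
  have h7 := mul_le_mul_of_nonneg_left s6 (show 0 ≤ 1 - c by linarith)
  have h8 := mul_le_mul_of_nonneg_left hl hc0
  linarith
end
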